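/- Let A be a C*-algebra and let I be an ideal of A. Then CQ(I) = I ∩ CQ(A). In particular, I has the centre-quotient (CQ) property if and only if I ⊆ CQ(A). -/

import Mathlib

open Filter Topology Pointwise

namespace CQP

variable {R : Type*} [NonUnitalRing R] [TopologicalSpace R]

/-- `I` is a closed two-sided ideal of the (C*-)algebra `S` (a subset of the ambient algebra). -/
def IsIdealOf (I S : Set R) : Prop :=
  I ⊆ S ∧ IsClosed I ∧ (0 : R) ∈ I ∧
  (∀ x ∈ I, ∀ y ∈ I, x + y ∈ I) ∧ (∀ x ∈ I, -x ∈ I) ∧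
  (∀ x ∈ I, ∀ a ∈ S, a * x ∈ I ∧ x * a ∈ I)

/-- The centre of the algebra `S`. -/
def centerOf (S : Set R) : Set R := {z ∈ S | ∀ x ∈ S, z * x = x * z}

/-- `e` is a unit for `S` relative to (modulo) the ideal `M`. -/
def IsRelUnitMod (S M : Set R) (e : R) : Prop :=
  e ∈ S ∧ ∀ x ∈ S, x - x * e ∈ M ∧ x - e * x ∈ M

/-- `M` is a modular maximal ideal of the algebra `S`. -/
def IsModMaxIdealOf (M S : Set R) : Prop :=
  IsIdealOf M S ∧ M ≠ S ∧
  (∀ I, IsIdealOf I S → M ⊆ I → I = M ∨ I = S) ∧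
  ∃ e, IsRelUnitMod S M e

/-- The algebra `S` is weakly central. -/
def WeaklyCentral (S : Set R) : Prop :=
  (∀ M, IsModMaxIdealOf M S → ¬ centerOf S ⊆ M) ∧
  (∀ M N, IsModMaxIdealOf M S → IsModMaxIdealOf N S →
    M ∩ centerOf S = N ∩ centerOf S → M = N)

/-- The algebra `S` has the centre-quotient property: every central element of a quotient
of `S` lifts to a central element of `S` modulo the ideal. -/
def HasCQ (S : Set R) : Prop :=
  ∀ I, IsIdealOf I S → ∀ a ∈ S, (∀ x ∈ S, a * x - x * a ∈ I) →
    ∃ z ∈ centerOf S, a - z ∈ I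

/-- `a` is a CQ-element of the algebra `S`. -/
def IsCQElem (S : Set R) (a : R) : Prop :=
  a ∈ S ∧ ∀ I, IsIdealOf I S → (∀ x ∈ S, a * x - x * a ∈ I) →
    ∃ z ∈ centerOf S, a - z ∈ I

/-- The set of CQ-elements of `S`. -/
def CQset (S : Set R) : Set R := {a | IsCQElem S a}

/-- The set `T_A` of modular maximal ideals witnessing the failure of weak centrality. -/
def Tset (S : Set R) : Set (Set R) :=
  {M | IsModMaxIdealOf M S ∧
    (centerOf S ⊆ M ∨ ∃ N, IsModMaxIdealOf N S ∧ N ≠ M ∧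
      ¬ centerOf S ⊆ M ∧ ¬ centerOf S ⊆ N ∧ M ∩ centerOf S = N ∩ centerOf S)}

/-- The closed two-sided ideal of `S` generated by the set `X`. -/
def genIdealOf (S X : Set R) : Set R := ⋂₀ {I | IsIdealOf I S ∧ X ⊆ I}

/-- The quotient `A/J` (of the full algebra by the ideal `J`) has the centre-quotient
property, expressed via the correspondence between ideals of `A/J` and ideals of `A`
containing `J`. -/
def HasCQmod (J : Set R) : Prop :=
  ∀ I : Set R, IsIdealOf I (Set.univ : Set R) → J ⊆ I → ∀ a : R,
    (∀ x : R, a * x - x * a ∈ I) →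
      ∃ z : R, (∀ x : R, z * x - x * z ∈ J) ∧ a - z ∈ I


end CQP

open CQP

section ApproximateUnit

variable {A : Type*} [NonUnitalCStarAlgebra A]

/-- In a C*-algebra, every `y` is approximated by `y * h` where `h = star y * y * g`. -/
theorem CStarAlgebra.exists_norm_sub_mul_star_mul_self_le (y : A) {δ : ℝ} (hδ : 0 < δ) :
    ∃ g : A, ‖y - y * (star y * y * g)‖ ^ 2 ≤ δ := by
  have hb : IsSelfAdjoint (star y * y) := IsSelfAdjoint.star_mul_self y
  have hpos (t : ℝ) : t ^ 2 + δ ^ 2 ≠ 0 := by positivity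
  set g : ℝ → ℝ := fun t => t / (t ^ 2 + δ ^ 2) with hg
  have hgc : Continuous g := by fun_prop (disch := exact hpos _)
  have hg0 : g 0 = 0 := by simp [hg]
  set f : ℝ → ℝ := fun t => t * g t with hf
  have hfc : Continuous f := by fun_prop
  have hf0 : f 0 = 0 := by simp [hf]
  refine ⟨cfcₙ g (star y * y), ?_⟩
  have hh : star y * y * cfcₙ g (star y * y) = cfcₙ f (star y * y) := by
    rw [cfcₙ_mul (fun t : ℝ => t) g (star y * y) (by fun_prop) rfl (by fun_prop) hg0,
      cfcₙ_id' ℝ (star y * y)]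
  rw [hh]
  set h := cfcₙ f (star y * y) with hh_def
  have hsa : star h = h := (cfcₙ_predicate f (star y * y) : IsSelfAdjoint h)
  have key : star (y - y * h) * (y - y * h)
      = cfcₙ (fun t : ℝ => (t - f t * t) - (t - f t * t) * f t) (star y * y) := by
    rw [cfcₙ_sub (fun t : ℝ => t - f t * t) (fun t : ℝ => (t - f t * t) * f t) (star y * y)
        (by fun_prop) (by simp) (by fun_prop) (by simp),
      cfcₙ_mul (fun t : ℝ => t - f t * t) f (star y * y) (by fun_prop) (by simp)
        (by fun_prop) hf0,
      cfcₙ_sub (fun t : ℝ => t) (fun t : ℝ => f t * t) (star y * y)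
        (by fun_prop) rfl (by fun_prop) (by simp),
      cfcₙ_mul f (fun t : ℝ => t) (star y * y) (by fun_prop) hf0 (by fun_prop) rfl,
      cfcₙ_id' ℝ (star y * y), ← hh_def]
    simp only [star_sub, star_mul, hsa]
    noncomm_ring
  rw [sq, ← CStarRing.norm_star_mul_self, key]
  refine norm_cfcₙ_le fun t _ => ?_
  have hform : (t - f t * t) - (t - f t * t) * f t = t * δ ^ 4 / (t ^ 2 + δ ^ 2) ^ 2 := by
    simp only [hf, hg]
    field_simp [hpos t]
    ring
  rw [hform, Real.norm_eq_abs, abs_div, abs_mul, abs_of_pos (by positivity : 0 < δ ^ 4),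
    abs_of_pos (by positivity : 0 < (t ^ 2 + δ ^ 2) ^ 2), div_le_iff₀ (by positivity)]
  have h1 : |t| * δ ≤ t ^ 2 + δ ^ 2 := by
    nlinarith [sq_nonneg (|t| - δ), sq_abs t, abs_nonneg t]
  have h2 : δ ^ 2 ≤ t ^ 2 + δ ^ 2 := by nlinarith [sq_nonneg t]
  calc |t| * δ ^ 4 = δ * ((|t| * δ) * δ ^ 2) := by ring
    _ ≤ δ * ((t ^ 2 + δ ^ 2) * (t ^ 2 + δ ^ 2)) := by gcongr
    _ = δ * (t ^ 2 + δ ^ 2) ^ 2 := by ring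

theorem CStarAlgebra.exists_tendsto_mul_star_mul_self (y : A) :
    ∃ u : ℕ → A, Tendsto (fun n => y * (star y * y * u n)) atTop (𝓝 y) := by
  choose u hu using fun n : ℕ =>
    CStarAlgebra.exists_norm_sub_mul_star_mul_self_le y (Nat.one_div_pos_of_nat (α := ℝ) (n := n))
  refine ⟨u, tendsto_iff_norm_sub_tendsto_zero.2 ?_⟩
  have hsq : Tendsto (fun n => ‖y - y * (star y * y * u n)‖ ^ 2) atTop (𝓝 0) :=
    squeeze_zero (fun _ => by positivity) hu tendsto_one_div_add_atTop_nhds_zero_nat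
  simpa [norm_sub_rev] using hsq.sqrt

end ApproximateUnit

namespace CQP

section Ring

variable {R : Type*} [NonUnitalRing R] [TopologicalSpace R] {I J S : Set R} {x y : R}

theorem IsIdealOf.add_mem (h : IsIdealOf I S) (hx : x ∈ I) (hy : y ∈ I) : x + y ∈ I :=
  h.2.2.2.1 x hx y hy

theorem IsIdealOf.sub_mem (h : IsIdealOf I S) (hx : x ∈ I) (hy : y ∈ I) : x - y ∈ I :=
  sub_eq_add_neg x y ▸ h.add_mem hx (h.2.2.2.2.1 y hy)

theorem IsIdealOf.mul_mem_left (h : IsIdealOf I S) (hx : x ∈ S) (hy : y ∈ I) : x * y ∈ I :=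
  (h.2.2.2.2.2 y hy x hx).1

theorem IsIdealOf.mul_mem_right (h : IsIdealOf I S) (hx : x ∈ I) (hy : y ∈ S) : x * y ∈ I :=
  (h.2.2.2.2.2 x hx y hy).2

theorem IsIdealOf.inter (hJ : IsIdealOf J Set.univ) (hI : IsIdealOf I Set.univ) :
    IsIdealOf (J ∩ I) I :=
  ⟨Set.inter_subset_right, hJ.2.1.inter hI.2.1, ⟨hJ.2.2.1, hI.2.2.1⟩,
    fun _ hx _ hy => ⟨hJ.add_mem hx.1 hy.1, hI.add_mem hx.2 hy.2⟩,
    fun x hx => ⟨hJ.2.2.2.2.1 x hx.1, hI.2.2.2.2.1 x hx.2⟩,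
    fun _ hx _ _ => ⟨⟨hJ.mul_mem_left trivial hx.1, hI.mul_mem_left trivial hx.2⟩,
      ⟨hJ.mul_mem_right hx.1 trivial, hI.mul_mem_right hx.2 trivial⟩⟩⟩

theorem hasCQ_iff_subset_CQset : HasCQ S ↔ S ⊆ CQset S :=
  ⟨fun h a ha => ⟨ha, fun I hI => h I hI a ha⟩, fun h I hI _ ha => (h ha).2 I hI⟩

end Ring

variable {A : Type*} [NonUnitalCStarAlgebra A] {I J : Set A} {a y : A}

theorem IsIdealOf.exists_tendsto_mul_right (hI : IsIdealOf I Set.univ) (hy : y ∈ I) :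
    ∃ u : ℕ → A, (∀ n, u n ∈ I) ∧ Tendsto (fun n => y * u n) atTop (𝓝 y) := by
  obtain ⟨u, hu⟩ := CStarAlgebra.exists_tendsto_mul_star_mul_self y
  exact ⟨fun n => star y * y * u n,
    fun n => hI.mul_mem_right (hI.mul_mem_left trivial hy) trivial, hu⟩

theorem IsIdealOf.exists_tendsto_mul_left (hI : IsIdealOf I Set.univ) (hy : y ∈ I) :
    ∃ u : ℕ → A, (∀ n, u n ∈ I) ∧ Tendsto (fun n => u n * y) atTop (𝓝 y) := by
  obtain ⟨u, hu⟩ := CStarAlgebra.exists_tendsto_mul_star_mul_self (star y)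
  refine ⟨fun n => star (u n) * (y * star y),
    fun n => hI.mul_mem_left trivial (hI.mul_mem_right hy trivial), ?_⟩
  simpa [mul_assoc] using hu.star

/-- In a C*-algebra, a closed ideal of a closed ideal is an ideal. -/
theorem IsIdealOf.trans (hJ : IsIdealOf J I) (hI : IsIdealOf I Set.univ) :
    IsIdealOf J Set.univ := by
  refine ⟨Set.subset_univ _, hJ.2.1, hJ.2.2.1, hJ.2.2.2.1, hJ.2.2.2.2.1,
    fun y hy x _ => ⟨?_, ?_⟩⟩
  · obtain ⟨u, huI, hu⟩ := hI.exists_tendsto_mul_left (hJ.1 hy)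
    refine hJ.2.1.mem_of_tendsto (hu.const_mul x) (Eventually.of_forall fun n => ?_)
    rw [← mul_assoc]
    exact hJ.mul_mem_left (hI.mul_mem_left trivial (huI n)) hy
  · obtain ⟨u, huI, hu⟩ := hI.exists_tendsto_mul_right (hJ.1 hy)
    refine hJ.2.1.mem_of_tendsto (hu.mul_const x) (Eventually.of_forall fun n => ?_)
    rw [mul_assoc]
    exact hJ.mul_mem_right hy (hI.mul_mem_right (huI n) trivial)

/-- An element of `I` that is central in `I` modulo `J` is central in the whole algebra
modulo `J`. -/
theorem IsIdealOf.commutator_mem (hI : IsIdealOf I Set.univ) (hJ : IsIdealOf J Set.univ)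
    (ha : a ∈ I) (h : ∀ x ∈ I, a * x - x * a ∈ J) (x : A) : a * x - x * a ∈ J := by
  obtain ⟨u, huI, hu⟩ := hI.exists_tendsto_mul_right
    (hI.sub_mem (hI.mul_mem_right ha (Set.mem_univ x)) (hI.mul_mem_left (Set.mem_univ x) ha))
  refine hJ.2.1.mem_of_tendsto hu (Eventually.of_forall fun n => ?_)
  have hsplit : (a * x - x * a) * u n
      = (a * (x * u n) - x * u n * a) - x * (a * u n - u n * a) := by noncomm_ring
  rw [hsplit]
  exact hJ.sub_mem (h _ (hI.mul_mem_left trivial (huI n)))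
    (hJ.mul_mem_left trivial (h _ (huI n)))

theorem isIdealOf_zero : IsIdealOf ({0} : Set A) Set.univ := by
  simp [IsIdealOf]

theorem IsIdealOf.centerOf_eq (hI : IsIdealOf I Set.univ) :
    centerOf I = I ∩ centerOf Set.univ := by
  ext z
  refine ⟨fun hz => ⟨hz.1, trivial, fun x _ => ?_⟩, fun hz => ⟨hz.1, fun x _ => hz.2.2 x trivial⟩⟩
  have := hI.commutator_mem isIdealOf_zero hz.1 (fun y hy => by simp [hz.2 y hy]) x
  exact sub_eq_zero.1 this

/-- The CQ-elements of an ideal are the CQ-elements of the algebra that lie in the ideal. -/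
theorem IsIdealOf.CQset_eq (hI : IsIdealOf I Set.univ) :
    CQset I = I ∩ CQset Set.univ := by
  ext a
  constructor
  · rintro ⟨ha, h⟩
    refine ⟨ha, trivial, fun J hJ hcomm => ?_⟩
    obtain ⟨z, hz, hza⟩ := h (J ∩ I) (hJ.inter hI) fun x _ =>
      ⟨hcomm x trivial, hI.sub_mem (hI.mul_mem_right ha trivial) (hI.mul_mem_left trivial ha)⟩
    rw [hI.centerOf_eq] at hz
    exact ⟨z, hz.2, hza.1⟩
  · rintro ⟨ha, -, h⟩
    refine ⟨ha, fun J hJ hcomm => ?_⟩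
    have hJA := hJ.trans hI
    obtain ⟨z, hz, hza⟩ := h J hJA fun x _ => hI.commutator_mem hJA ha hcomm x
    refine ⟨z, ?_, hza⟩
    rw [hI.centerOf_eq]
    exact ⟨by simpa using hI.sub_mem ha (hJ.1 hza), hz⟩

end CQP

/-- **Proposition 4.3 (c).** For any ideal `I` of a C*-algebra `A`, `CQ(I) = I ∩ CQ(A)`.
In particular, `I` has the CQ-property if and only if `I ⊆ CQ(A)`. -/
theorem stmt12 {A : Type*} [NonUnitalCStarAlgebra A] (I : Set A)
    (hI : IsIdealOf I (Set.univ : Set A)) :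
    CQset I = I ∩ CQset (Set.univ : Set A) ∧
    (HasCQ I ↔ I ⊆ CQset (Set.univ : Set A)) := by
  refine ⟨hI.CQset_eq, ?_⟩
  rw [hasCQ_iff_subset_CQset, hI.CQset_eq, Set.subset_inter_iff]
  exact and_iff_right subset_rfl
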